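/- Let Σ ∈ ℝ^{p×p} be symmetric positive-definite, v̂, μ ∈ ℝ^p, r̄₁ ≥ 0, and suppose ‖μ − Σv̂‖₂ ≥ 1.32·10⁵ · r̄₁. Let θ̃ ∈ ℝ and ṽ ∈ ℝ^p with ‖ṽ‖₂ ≤ 1 satisfy: (1/78.125)‖μ − Σv̂‖₂ − 1666.68·r̄₁ ≤ θ̃; θ̃ ≤ ‖μ − Σv̂‖₂ + 1666.68·r̄₁; and ⟨ṽ, μ − Σv̂⟩ ≤ −(1/156.25)‖μ − Σv̂‖₂. Let c̄* := 1.045752·10⁻⁶, Δ̄₀ := 1.093597·10⁻¹², and μ⁺ := μ + c̄*·θ̃·ṽ. Then ‖μ⁺ − Σv̂‖₂² ≤ (1 − Δ̄₀)·‖μ − Σv̂‖₂². -/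

import Mathlib

open Matrix

/-- Euclidean norm of a vector in `ℝ^p`. -/
noncomputable def nrm {p : ℕ} (v : Fin p → ℝ) : ℝ := Real.sqrt (v ⬝ᵥ v)

theorem nrm_nonneg {p : ℕ} (v : Fin p → ℝ) : 0 ≤ nrm v := Real.sqrt_nonneg _

theorem nrm_sq {p : ℕ} (v : Fin p → ℝ) : nrm v ^ 2 = v ⬝ᵥ v :=
  Real.sq_sqrt (Finset.sum_nonneg fun _ _ => mul_self_nonneg _)

theorem nrm_add_smul_sq {p : ℕ} (d v : Fin p → ℝ) (t : ℝ) :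
    nrm (d + t • v) ^ 2 = nrm d ^ 2 + 2 * t * (v ⬝ᵥ d) + t ^ 2 * nrm v ^ 2 := by
  simp only [nrm_sq, add_dotProduct, dotProduct_add, smul_dotProduct, dotProduct_smul,
    smul_eq_mul, dotProduct_comm d v]
  ring

/-- one step of the inner (mean-estimation) descent contracts the
distance to `Σv̂` by the factor `1 - Δ̄₀`. -/
theorem stmt_19 {p : ℕ}
    (S : Matrix (Fin p) (Fin p) ℝ) (hS : S.PosDef)
    (vhat μ : Fin p → ℝ) (r1bar : ℝ) (hr1bar : 0 ≤ r1bar)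
    (hfar : 1.32 * 10 ^ 5 * r1bar ≤ nrm (μ - S.mulVec vhat))
    (θ : ℝ) (v : Fin p → ℝ) (hv : nrm v ≤ 1)
    (hlow : (1 / 78.125) * nrm (μ - S.mulVec vhat) - 1666.68 * r1bar ≤ θ)
    (hup : θ ≤ nrm (μ - S.mulVec vhat) + 1666.68 * r1bar)
    (hdesc : v ⬝ᵥ (μ - S.mulVec vhat) ≤ -(1 / 156.25) * nrm (μ - S.mulVec vhat)) :
    nrm (μ + (1.045752 / 10 ^ 6 * θ) • v - S.mulVec vhat) ^ 2 ≤
      (1 - 1.093597 / 10 ^ 12) * nrm (μ - S.mulVec vhat) ^ 2 := by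
  rw [add_sub_right_comm, nrm_add_smul_sq]
  have hD := nrm_nonneg (μ - S.mulVec vhat)
  generalize nrm (μ - S.mulVec vhat) = D at *
  generalize v ⬝ᵥ (μ - S.mulVec vhat) = w at *
  obtain ⟨t, ht⟩ : ∃ t, t = 1.045752 / 10 ^ 6 * θ := ⟨_, rfl⟩
  rw [← ht]
  have hta : 1.8 / 10 ^ 10 * D ≤ t := by
    norm_num at *
    linarith
  have htb : 0.0127 * D ≤ 0.0128 * D - t := by
    norm_num at *
    linarith
  have ht0 : 0 ≤ t := le_trans (by positivity) hta
  have hw : t * w ≤ t * (-(1 / 156.25) * D) := mul_le_mul_of_nonneg_left hdesc ht0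
  have hvv : t ^ 2 * nrm v ^ 2 ≤ t ^ 2 * 1 :=
    mul_le_mul_of_nonneg_left (pow_le_one₀ (nrm_nonneg v) hv) (sq_nonneg t)
  have hprod : 1.8 / 10 ^ 10 * D * (0.0127 * D) ≤ t * (0.0128 * D - t) :=
    mul_le_mul hta htb (by positivity) ht0
  norm_num at *
  nlinarith [sq_nonneg D]
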